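/- For every real number r > 0, the function g ↦ e^{−|g|_r / r} is positive definite on the graph product G(Γ). -/

import Mathlib

open scoped ComplexOrder commutatorElement

/-! ## Operator-norm notions -/

/-- `φ` is completely bounded (as a Herz–Schur multiplier) with cb-norm at most `C`:
there are a Hilbert space `H` and bounded maps `α β : G → H` with
`φ (h⁻¹ * g) = ⟪α g, β h⟫` and `(sup ‖α‖) * (sup ‖β‖) ≤ C`. -/
def HasCBNormBound {G : Type} [Group G] (φ : G → ℂ) (C : ℝ) : Prop :=
  ∃ (H : Type) (_ : NormedAddCommGroup H) (_ : InnerProductSpace ℂ H)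
    (α β : G → H) (Ca Cb : ℝ),
      (∀ g, ‖α g‖ ≤ Ca) ∧ (∀ h, ‖β h‖ ≤ Cb) ∧ Ca * Cb ≤ C ∧
      ∀ g h : G, φ (h⁻¹ * g) = (inner ℂ (α g) (β h) : ℂ)

/-- A kernel `φ : G × G → ℂ` is completely bounded with cb-norm at most `C`. -/
def HasCBKernelBound {G : Type} (φ : G → G → ℂ) (C : ℝ) : Prop :=
  ∃ (H : Type) (_ : NormedAddCommGroup H) (_ : InnerProductSpace ℂ H)
    (α β : G → H) (Ca Cb : ℝ),
      (∀ g, ‖α g‖ ≤ Ca) ∧ (∀ h, ‖β h‖ ≤ Cb) ∧ Ca * Cb ≤ C ∧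
      ∀ g h : G, φ g h = (inner ℂ (α g) (β h) : ℂ)

/-- A function `φ : G → ℂ` is positive definite. -/
def IsPosDefFn {G : Type} [Group G] (φ : G → ℂ) : Prop :=
  ∀ (n : ℕ) (c : Fin n → ℂ) (x : Fin n → G),
    0 ≤ ∑ i, ∑ j, c i * (starRingEnd ℂ) (c j) * φ ((x j)⁻¹ * x i)

/-- A kernel `Ψ : G × G → ℂ` is positive definite. -/
def IsPosDefKernel {X : Type} (Ψ : X → X → ℂ) : Prop :=
  ∀ (n : ℕ) (c : Fin n → ℂ) (x : Fin n → X),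
    0 ≤ ∑ i, ∑ j, c i * (starRingEnd ℂ) (c j) * Ψ (x i) (x j)

/-- A (discrete) group is amenable iff it admits an approximate identity of finitely
supported positive definite functions; we use this characterization. -/
def AmenablePD (G : Type) [Group G] : Prop :=
  ∀ (S : Finset G) (ε : ℝ), 0 < ε →
    ∃ φ : G → ℂ, (Function.support φ).Finite ∧ IsPosDefFn φ ∧ ∀ g ∈ S, ‖φ g - 1‖ < ε

/-- A group is weakly amenable with Cowling–Haagerup constant 1: there is a net of finitely
supported completely bounded functions converging to 1 pointwise with cb-norms with
limsup at most 1. -/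
def WeaklyAmenableCH1 (G : Type) [Group G] : Prop :=
  ∀ (S : Finset G) (ε : ℝ), 0 < ε →
    ∃ φ : G → ℂ, (Function.support φ).Finite ∧ HasCBNormBound φ (1 + ε) ∧
      ∀ g ∈ S, ‖φ g - 1‖ < ε

/-! ## Graph products -/

section GraphProd

variable {V : Type} (Γ : SimpleGraph V) (G : V → Type) [∀ v, Group (G v)]

/-- The commutators `[G_v, G_w]` over the edges of `Γ`. -/
def commRels : Set (Monoid.CoprodI G) :=
  {x | ∃ (v w : V) (a : G v) (b : G w), Γ.Adj v w ∧
    x = ⁅Monoid.CoprodI.of a, Monoid.CoprodI.of b⁆}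

/-- The graph product of the groups `G v` over the graph `Γ`. -/
abbrev GraphProduct :=
  Monoid.CoprodI G ⧸ Subgroup.normalClosure (commRels Γ G)

/-- The image in the graph product of a syllable, i.e. an element of a vertex group. -/
def ofSyl (s : (v : V) × G v) : GraphProduct Γ G :=
  QuotientGroup.mk (Monoid.CoprodI.of s.2)

/-- The element of the graph product represented by a formal word of syllables. -/
def wordProd (w : List ((v : V) × G v)) : GraphProduct Γ G :=
  (w.map (ofSyl Γ G)).prod

/-- `w` is a formal word of nontrivial syllables representing `g`. -/
def IsWordOf (w : List ((v : V) × G v)) (g : GraphProduct Γ G) : Prop :=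
  (∀ s ∈ w, s.2 ≠ 1) ∧ wordProd Γ G w = g

/-- The reduced word length `|g|_r`. -/
noncomputable def redLength (g : GraphProduct Γ G) : ℕ :=
  sInf {n | ∃ w, IsWordOf Γ G w g ∧ w.length = n}

/-- `w` is a reduced word representing `g` : a representing word of nontrivial syllables
of minimal syllable length. -/
def IsReducedWordOf (w : List ((v : V) × G v)) (g : GraphProduct Γ G) : Prop :=
  IsWordOf Γ G w g ∧ ∀ w', IsWordOf Γ G w' g → w.length ≤ w'.length

/-- `κ`: the maximal number of mutually adjacent vertices of `Γ`. -/
noncomputable def kappa : ℕ :=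
  sSup {n | ∃ s : Finset V, Γ.IsNClique n s}

/-- The `d`-tail of `g`: syllables appearing among the last `d` syllables of some reduced
word representing `g`. -/
def dTail (g : GraphProduct Γ G) (d : ℕ) : Set ((v : V) × G v) :=
  {s | ∃ w, IsReducedWordOf Γ G w g ∧ s ∈ w.drop (w.length - d)}

/-- `g` begins with `G_v`. -/
def BeginsWith (g : GraphProduct Γ G) (v : V) : Prop :=
  ∃ w s, IsReducedWordOf Γ G w g ∧ w.head? = some s ∧ s.1 = v

/-- `g` ends with `G(lk(v))`: some reduced word for `g` has last syllable in a vertex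
group adjacent to `v`. -/
def EndsWithLink (g : GraphProduct Γ G) (v : V) : Prop :=
  ∃ w s, IsReducedWordOf Γ G w g ∧ w.getLast? = some s ∧ Γ.Adj s.1 v

/-- The half-space `𝔸_v` of elements beginning with `G_v`. -/
noncomputable def halfSpace (v : V) : Set (GraphProduct Γ G) :=
  {g | ∃ gv : G v, redLength Γ G (ofSyl Γ G ⟨v, gv⟩ * g) < redLength Γ G g}

/-- Left translate `k • s` of a subset of the graph product. -/
def wallTrans (k : GraphProduct Γ G) (s : Set (GraphProduct Γ G)) : Set (GraphProduct Γ G) :=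
  (fun x => k * x) '' s

/-- Two walls (given by their preferred half-spaces) cross if all four intersections of
half-spaces are nonempty. -/
def Cross {X : Type} (s t : Set X) : Prop :=
  (s ∩ t).Nonempty ∧ (s ∩ tᶜ).Nonempty ∧ (sᶜ ∩ t).Nonempty ∧ (sᶜ ∩ tᶜ).Nonempty

/-- The set of walls `𝕎 = {k𝔸_v}`. -/
noncomputable def Walls : Set (Set (GraphProduct Γ G)) :=
  {s | ∃ (k : GraphProduct Γ G) (v : V), s = wallTrans Γ G k (halfSpace Γ G v)}

/-- The wall (pseudo)distance: the number of walls separating `x` and `y`. -/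
noncomputable def wallDist (x y : GraphProduct Γ G) : ℕ :=
  {s | s ∈ Walls Γ G ∧ Xor' (x ∈ s) (y ∈ s)}.ncard

end GraphProd


/-- The image in the free product `A ∗ B` of a syllable. -/
def sylEmb (A B : Type) [Group A] [Group B] : A ⊕ B → Monoid.Coprod A B :=
  Sum.elim (fun a => Monoid.Coprod.inl a) (fun b => Monoid.Coprod.inr b)


section Helpers

open Classical

variable {V : Type} (Γ : SimpleGraph V) (G : V → Type) [∀ v, Group (G v)]

noncomputable def gpIncl (v : V) : G v →* GraphProduct Γ G :=
  (QuotientGroup.mk' _).comp Monoid.CoprodI.of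

noncomputable def gpLift {H : Type} [Group H] (f : ∀ v, G v →* H)
    (hc : ∀ v w (a : G v) (b : G w), Γ.Adj v w → Commute (f v a) (f w b)) :
    GraphProduct Γ G →* H :=
  QuotientGroup.lift _ (Monoid.CoprodI.lift f) (by
    have : Subgroup.normalClosure (commRels Γ G) ≤ (Monoid.CoprodI.lift f).ker := by
      apply Subgroup.normalClosure_le_normal
      rintro x ⟨v, w, a, b, h, rfl⟩
      have := hc v w a b h
      simp only [SetLike.mem_coe, MonoidHom.mem_ker, map_commutatorElement,
        Monoid.CoprodI.lift_of]
      exact commutatorElement_eq_one_iff_commute.2 this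
    exact this)

theorem gpLift_ofSyl {H : Type} [Group H] (f : ∀ v, G v →* H)
    (hc : ∀ v w (a : G v) (b : G w), Γ.Adj v w → Commute (f v a) (f w b)) (s : (v : V) × G v) :
    gpLift Γ G f hc (ofSyl Γ G s) = f s.1 s.2 := by
  unfold gpLift ofSyl
  erw [QuotientGroup.lift_mk]

theorem gpIncl_commute {v w : V} (h : Γ.Adj v w) (a : G v) (b : G w) :
    Commute (ofSyl Γ G ⟨v, a⟩) (ofSyl Γ G ⟨w, b⟩) := by
  rw [← commutatorElement_eq_one_iff_commute]
  have : (⁅Monoid.CoprodI.of a, Monoid.CoprodI.of b⁆ : Monoid.CoprodI G) ∈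
      Subgroup.normalClosure (commRels Γ G) :=
    Subgroup.subset_normalClosure ⟨v, w, a, b, h, rfl⟩
  have h2 := (QuotientGroup.eq_one_iff _).2 this
  exact h2

theorem ofSyl_mul (v : V) (a b : G v) :
    ofSyl Γ G ⟨v, a * b⟩ = ofSyl Γ G ⟨v, a⟩ * ofSyl Γ G ⟨v, b⟩ :=
  map_mul (gpIncl Γ G v) a b

theorem ofSyl_one (v : V) : ofSyl Γ G ⟨v, 1⟩ = 1 := map_one (gpIncl Γ G v)

theorem ofSyl_inv (v : V) (a : G v) : ofSyl Γ G ⟨v, a⁻¹⟩ = (ofSyl Γ G ⟨v, a⟩)⁻¹ :=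
  map_inv (gpIncl Γ G v) a

theorem wordProd_nil : wordProd Γ G [] = 1 := rfl

theorem wordProd_cons (s : (v : V) × G v) (w) :
    wordProd Γ G (s :: w) = ofSyl Γ G s * wordProd Γ G w := by
  simp [wordProd]

theorem wordProd_append (w w' : List ((v : V) × G v)) :
    wordProd Γ G (w ++ w') = wordProd Γ G w * wordProd Γ G w' := by
  simp [wordProd]

theorem exists_word (g : GraphProduct Γ G) : ∃ w, wordProd Γ G w = g := by
  obtain ⟨x, rfl⟩ := QuotientGroup.mk_surjective g
  induction x using Monoid.CoprodI.induction_on with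
  | one => exact ⟨[], rfl⟩
  | of i m => exact ⟨[⟨i, m⟩], by simp [wordProd, ofSyl]⟩
  | mul x y hx hy =>
    obtain ⟨w, hw⟩ := hx
    obtain ⟨w', hw'⟩ := hy
    exact ⟨w ++ w', by rw [wordProd_append, hw, hw']; rfl⟩

theorem wordProd_filter_ne (w : List ((v : V) × G v)) :
    wordProd Γ G (w.filter (fun s => s.2 ≠ 1)) = wordProd Γ G w := by
  induction w with
  | nil => rfl
  | cons s w ih =>
    obtain ⟨v, a⟩ := s
    by_cases h : a = 1
    · subst h
      rw [List.filter_cons_of_neg (by simp), ih, wordProd_cons, ofSyl_one, one_mul]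
    · rw [List.filter_cons_of_pos (by simpa using h), wordProd_cons, wordProd_cons, ih]

def Geo (w : List ((v : V) × G v)) : Prop :=
  ∀ w', wordProd Γ G w' = wordProd Γ G w → w.length ≤ w'.length

theorem exists_geo (g : GraphProduct Γ G) :
    ∃ w, (∀ s ∈ w, s.2 ≠ 1) ∧ wordProd Γ G w = g ∧ Geo Γ G w ∧ w.length = redLength Γ G g := by
  obtain ⟨w₀, h₀⟩ := exists_word Γ G g
  have hne : {n | ∃ w, IsWordOf Γ G w g ∧ w.length = n}.Nonempty :=
    ⟨_, w₀.filter (fun s => s.2 ≠ 1), ⟨fun s hs => by simpa using (List.mem_filter.1 hs).2,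
      by rw [wordProd_filter_ne, h₀]⟩, rfl⟩
  obtain ⟨w, ⟨h1, h2⟩, h3⟩ := Nat.sInf_mem hne
  refine ⟨w, h1, h2, ?_, h3⟩
  intro w' hw'
  rw [h3]
  refine le_trans (Nat.sInf_le ⟨w'.filter (fun s => s.2 ≠ 1),
    ⟨fun s hs => by simpa using (List.mem_filter.1 hs).2, ?_⟩, rfl⟩) (List.length_filter_le _ _)
  rw [wordProd_filter_ne, hw', h2]

/-- retraction onto the link of `v` -/
noncomputable def gpRet (v : V) : GraphProduct Γ G →* GraphProduct Γ G :=
  gpLift Γ G (fun w => if Γ.Adj v w then gpIncl Γ G w else 1) (by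
    intro u w a b h
    by_cases h1 : Γ.Adj v u <;> by_cases h2 : Γ.Adj v w <;> simp [h1, h2]
    exact gpIncl_commute Γ G h a b)

theorem gpRet_ofSyl (v : V) (s : (v : V) × G v) :
    gpRet Γ G v (ofSyl Γ G s) = if Γ.Adj v s.1 then ofSyl Γ G s else 1 := by
  unfold gpRet
  rw [gpLift_ofSyl]
  split_ifs <;> rfl

theorem gpRet_wordProd (v : V) (w : List ((v : V) × G v)) :
    gpRet Γ G v (wordProd Γ G w) = wordProd Γ G (w.filter (fun s => Γ.Adj v s.1)) := by
  induction w with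
  | nil => exact map_one _
  | cons s w ih =>
    rw [wordProd_cons, map_mul, ih, gpRet_ofSyl]
    by_cases h : Γ.Adj v s.1
    · rw [List.filter_cons_of_pos (by simpa using h), wordProd_cons, if_pos h]
    · rw [List.filter_cons_of_neg (by simpa using h), if_neg h, one_mul]

theorem gpRet_commute (v : V) (a : G v) (y : GraphProduct Γ G) :
    Commute (ofSyl Γ G ⟨v, a⟩) (gpRet Γ G v y) := by
  obtain ⟨w, rfl⟩ := exists_word Γ G y
  induction w with
  | nil => rw [wordProd_nil, map_one]; exact Commute.one_right _
  | cons s w ih =>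
    rw [wordProd_cons, map_mul, gpRet_ofSyl]
    refine Commute.mul_right ?_ ih
    split_ifs with h
    · exact gpIncl_commute Γ G h a s.2
    · exact Commute.one_right _

/-- the subgroup of the star of `v` -/
noncomputable def gpStar (v : V) : Subgroup (GraphProduct Γ G) where
  carrier := {y | ∃ a : G v, y = ofSyl Γ G ⟨v, a⟩ * gpRet Γ G v y}
  one_mem' := ⟨1, by rw [ofSyl_one, map_one, one_mul]⟩
  mul_mem' := by
    rintro x y ⟨a, ha⟩ ⟨b, hb⟩
    refine ⟨a * b, ?_⟩
    conv_lhs => rw [ha, hb]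
    rw [ofSyl_mul, map_mul, mul_assoc, mul_assoc, ← mul_assoc (gpRet Γ G v x),
      ← (gpRet_commute Γ G v b x).eq, mul_assoc]
  inv_mem' := by
    rintro x ⟨a, ha⟩
    refine ⟨a⁻¹, ?_⟩
    conv_lhs => rw [ha]
    rw [mul_inv_rev, ofSyl_inv, map_inv, ((gpRet_commute Γ G v a x).inv_inv).eq]

theorem ofSyl_mem_star {v w : V} (h : w = v ∨ Γ.Adj v w) (a : G w) :
    ofSyl Γ G ⟨w, a⟩ ∈ gpStar Γ G v := by
  rcases h with rfl | h
  · refine ⟨a, ?_⟩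
    rw [gpRet_ofSyl, if_neg (by simp), mul_one]
  · refine ⟨1, ?_⟩
    rw [gpRet_ofSyl, if_pos h, ofSyl_one, one_mul]

noncomputable def gpActFn (v w : V) (s : G w) (p : GraphProduct Γ G × G v) :
    GraphProduct Γ G × G v := (ofSyl Γ G ⟨w, s⟩ * p.1,
    if p.1 ∈ gpStar Γ G v then (Pi.mulSingle w s : ∀ u, G u) v * p.2 else p.2)

noncomputable def gpActEnd (v w : V) : G w →* Function.End (GraphProduct Γ G × G v) where
  toFun s := gpActFn Γ G v w s
  map_one' := by
    funext p
    change gpActFn Γ G v w 1 p = p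
    simp [gpActFn, ofSyl_one]
  map_mul' s t := by
    funext p
    change gpActFn Γ G v w (s * t) p = gpActFn Γ G v w s (gpActFn Γ G v w t p)
    unfold gpActFn
    rw [Prod.mk.injEq]
    refine ⟨by rw [ofSyl_mul, mul_assoc], ?_⟩
    by_cases h : w = v
    · subst h
      have := (gpStar Γ G w).mul_mem_cancel_left (y := p.1)
        (ofSyl_mem_star Γ G (Or.inl rfl) t)
      dsimp only
      rw [this]
      split_ifs <;> simp [mul_assoc]
    · simp [Pi.mulSingle_eq_of_ne (Ne.symm h)]

noncomputable def gpAct (v : V) : GraphProduct Γ G →* Equiv.Perm (GraphProduct Γ G × G v) :=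
  gpLift Γ G (fun w => (gpActEnd Γ G v w).toHomPerm) (by
    intro u w a b h
    have hne := h.ne
    ext1 p
    change gpActFn Γ G v u a (gpActFn Γ G v w b p) = gpActFn Γ G v w b (gpActFn Γ G v u a p)
    unfold gpActFn
    rw [Prod.mk.injEq]
    dsimp only
    refine ⟨?_, ?_⟩
    · rw [← mul_assoc, ← mul_assoc, (gpIncl_commute Γ G h a b).eq]
    · by_cases hu : u = v
      · subst hu
        have := (gpStar Γ G u).mul_mem_cancel_left (y := p.1)
          (ofSyl_mem_star Γ G (Or.inr h) b)
        rw [this]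
        simp [Pi.mulSingle_eq_of_ne hne]
      · by_cases hw : w = v
        · subst hw
          have := (gpStar Γ G w).mul_mem_cancel_left (y := p.1)
            (ofSyl_mem_star Γ G (Or.inr h.symm) a)
          rw [this]
          simp [Pi.mulSingle_eq_of_ne (Ne.symm hu)]
        · simp [Pi.mulSingle_eq_of_ne (Ne.symm hu), Pi.mulSingle_eq_of_ne (Ne.symm hw)])

theorem gpAct_ofSyl (v : V) (s : (v : V) × G v) (p : GraphProduct Γ G × G v) :
    gpAct Γ G v (ofSyl Γ G s) p = (ofSyl Γ G s * p.1,
    if p.1 ∈ gpStar Γ G v then (Pi.mulSingle s.1 s.2 : ∀ u, G u) v * p.2 else p.2) := by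
  have h : gpAct Γ G v (ofSyl Γ G s) = (gpActEnd Γ G v s.1).toHomPerm s.2 :=
    gpLift_ofSyl Γ G _ _ s
  rw [h]
  rfl

theorem gpAct_fst (v : V) (y : GraphProduct Γ G) (p : GraphProduct Γ G × G v) :
    (gpAct Γ G v y p).1 = y * p.1 := by
  obtain ⟨w, rfl⟩ := exists_word Γ G y
  induction w with
  | nil => rw [wordProd_nil, map_one, one_mul]; rfl
  | cons s w ih =>
    rw [wordProd_cons, map_mul, Equiv.Perm.mul_apply, gpAct_ofSyl, ih, mul_assoc]

noncomputable def gpF (v : V) (y : GraphProduct Γ G) : G v := (gpAct Γ G v y (1, 1)).2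

theorem gpF_mul (v : V) (s : (v : V) × G v) (y : GraphProduct Γ G) :
    gpF Γ G v (ofSyl Γ G s * y) = if y ∈ gpStar Γ G v then
      (Pi.mulSingle s.1 s.2 : ∀ u, G u) v * gpF Γ G v y else gpF Γ G v y := by
  unfold gpF
  rw [map_mul, Equiv.Perm.mul_apply, gpAct_ofSyl, gpAct_fst, mul_one]

/-- hyperplanes -/
abbrev GpHyp := (v : V) × (GraphProduct Γ G ⧸ gpStar Γ G v)

noncomputable def hypF (h : GpHyp Γ G) (x : GraphProduct Γ G) : G h.1 :=
  gpF Γ G h.1 (x⁻¹ * h.2.out)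

theorem hypF_step (h : GpHyp Γ G) (x : GraphProduct Γ G) (s : (v : V) × G v) (hs : s.2 ≠ 1) :
    hypF Γ G h x ≠ hypF Γ G h (x * ofSyl Γ G s) ↔ h = ⟨s.1, QuotientGroup.mk x⟩ := by
  obtain ⟨w, a⟩ := s
  obtain ⟨v, k⟩ := h
  unfold hypF
  rw [mul_inv_rev, ← ofSyl_inv, mul_assoc, gpF_mul]
  have hk : (x⁻¹ * k.out ∈ gpStar Γ G v) ↔ k = QuotientGroup.mk x := by
    rw [← QuotientGroup.eq, QuotientGroup.out_eq']
    exact eq_comm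
  dsimp only at hs ⊢
  rw [hk]
  by_cases hv : w = v
  · subst hv
    by_cases hx : k = QuotientGroup.mk x
    · simp [hx, hs]
    · simp [hx]
  · have : v ≠ w := Ne.symm hv
    simp [Pi.mulSingle_eq_of_ne this, this]

noncomputable def hyps : GraphProduct Γ G → List ((v : V) × G v) → List (GpHyp Γ G)
  | _, [] => []
  | x, s :: w => ⟨s.1, QuotientGroup.mk x⟩ :: hyps (x * ofSyl Γ G s) w

theorem hyps_length (x : GraphProduct Γ G) (w : List ((v : V) × G v)) :
    (hyps Γ G x w).length = w.length := by
  induction w generalizing x with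
  | nil => rfl
  | cons s w ih => simp [hyps, ih]

theorem hyps_sub (h : GpHyp Γ G) (x : GraphProduct Γ G) (w : List ((v : V) × G v))
    (hw : ∀ s ∈ w, s.2 ≠ 1) (hh : h ∉ hyps Γ G x w) :
    hypF Γ G h x = hypF Γ G h (x * wordProd Γ G w) := by
  induction w generalizing x with
  | nil => rw [wordProd_nil, mul_one]
  | cons s w ih =>
    simp only [hyps, List.mem_cons, not_or] at hh
    rw [wordProd_cons, ← mul_assoc, ← ih _ (fun t ht => hw t (by simp [ht])) hh.2]
    by_contra hc
    exact hh.1 ((hypF_step Γ G h x s (hw s (by simp))).1 hc)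

theorem hyps_sup (h : GpHyp Γ G) (x : GraphProduct Γ G) (w : List ((v : V) × G v))
    (hw : ∀ s ∈ w, s.2 ≠ 1) (hn : (hyps Γ G x w).Nodup) (hh : h ∈ hyps Γ G x w) :
    hypF Γ G h x ≠ hypF Γ G h (x * wordProd Γ G w) := by
  induction w generalizing x with
  | nil => simp [hyps] at hh
  | cons s w ih =>
    have hw' : ∀ t ∈ w, t.2 ≠ 1 := fun t ht => hw t (by simp [ht])
    have hst := hypF_step Γ G h x s (hw s (by simp))
    simp only [hyps, List.nodup_cons] at hn
    simp only [hyps, List.mem_cons] at hh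
    rw [wordProd_cons, ← mul_assoc]
    by_cases h0 : h = ⟨s.1, QuotientGroup.mk x⟩
    · rw [← hyps_sub Γ G h _ w hw' (by rw [h0]; exact hn.1)]
      exact hst.2 h0
    · have := not_not.1 (mt hst.1 h0)
      rw [this]
      exact ih _ hw' hn.2 (hh.resolve_left h0)

theorem mem_hyps (h : GpHyp Γ G) (x : GraphProduct Γ G) (w : List ((v : V) × G v))
    (hh : h ∈ hyps Γ G x w) : ∃ m t q, w = m ++ t :: q ∧
      h = ⟨t.1, QuotientGroup.mk (x * wordProd Γ G m)⟩ := by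
  induction w generalizing x with
  | nil => simp [hyps] at hh
  | cons s w ih =>
    simp only [hyps, List.mem_cons] at hh
    rcases hh with rfl | hh
    · exact ⟨[], s, w, rfl, by rw [wordProd_nil, mul_one]⟩
    · obtain ⟨m, t, q, rfl, rfl⟩ := ih _ hh
      exact ⟨s :: m, t, q, rfl, by rw [wordProd_cons, mul_assoc]⟩

theorem hyps_nodup (x : GraphProduct Γ G) (w : List ((v : V) × G v)) (hg : Geo Γ G w) :
    (hyps Γ G x w).Nodup := by
  induction w generalizing x with
  | nil => simp [hyps]
  | cons s w ih =>
    simp only [hyps, List.nodup_cons]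
    refine ⟨?_, ih _ ?_⟩
    · intro hmem
      obtain ⟨m, t, q, rfl, he⟩ := mem_hyps Γ G _ _ _ hmem
      obtain ⟨v, a⟩ := s
      obtain ⟨u, b⟩ := t
      obtain ⟨rfl, he⟩ := Sigma.mk.inj_iff.1 he
      have he := eq_of_heq he
      rw [QuotientGroup.eq] at he
      obtain ⟨c, hc⟩ := he
      have e1 : x⁻¹ * (x * ofSyl Γ G ⟨v, a⟩ * wordProd Γ G m)
          = ofSyl Γ G ⟨v, a⟩ * wordProd Γ G m := by group
      rw [e1, map_mul, gpRet_ofSyl, if_neg (by simp), one_mul] at hc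
      have := hg (⟨v, c * b⟩ :: m.filter (fun s => Γ.Adj v s.1) ++ q) (by
        rw [wordProd_append, wordProd_cons, wordProd_cons, wordProd_append, wordProd_cons,
          ← mul_assoc, ← mul_assoc, hc, ← gpRet_wordProd, ofSyl_mul,
          mul_assoc (ofSyl Γ G ⟨v, c⟩), (gpRet_commute Γ G v b _).eq, ← mul_assoc])
      have h2 := List.length_filter_le (fun s : (v : V) × G v => decide (Γ.Adj v s.1)) m
      simp only [List.length_cons, List.length_append, List.cons_append] at this
      omega
    · intro w' hw'
      have := hg (s :: w') (by rw [wordProd_cons, wordProd_cons, hw'])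
      simpa using this

theorem exists_sep (x y : GraphProduct Γ G) : ∃ S : Finset (GpHyp Γ G),
    (∀ h, h ∈ S ↔ hypF Γ G h x ≠ hypF Γ G h y) ∧ S.card = redLength Γ G (y⁻¹ * x) := by
  obtain ⟨w, h1, h2, h3, h4⟩ := exists_geo Γ G (y⁻¹ * x)
  have hn := hyps_nodup Γ G y w h3
  have hy : y * wordProd Γ G w = x := by rw [h2]; group
  refine ⟨(hyps Γ G y w).toFinset, fun h => ?_, ?_⟩
  · rw [List.mem_toFinset, ne_comm, ← hy]
    refine ⟨hyps_sup Γ G h y w h1 hn, fun hh => ?_⟩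
    by_contra hc
    exact hh (hyps_sub Γ G h y w h1 hc)
  · rw [List.toFinset_card_of_nodup hn, hyps_length, h4]

theorem indicator_pd {n : ℕ} {X : Type} (f : Fin n → X) (c : Fin n → ℂ) :
    0 ≤ ∑ i, ∑ j, c i * (starRingEnd ℂ) (c j) * (if f i = f j then 1 else 0) := by
  have : ∑ i, ∑ j, c i * (starRingEnd ℂ) (c j) * (if f i = f j then 1 else 0)
      = ∑ t ∈ Finset.univ.image f, (∑ i, if f i = t then c i else 0) *
        (starRingEnd ℂ) (∑ i, if f i = t then c i else 0) := by
    simp_rw [map_sum, Finset.sum_mul_sum]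
    conv_rhs => rw [Finset.sum_comm]
    refine Finset.sum_congr rfl fun i _ => ?_
    conv_rhs => rw [Finset.sum_comm]
    refine Finset.sum_congr rfl fun j _ => ?_
    rw [Finset.sum_eq_single (f i)]
    · by_cases h : f i = f j
      · simp [h]
      · simp [h, Ne.symm h]
    · intro b _ hb
      simp [Ne.symm hb]
    · intro h
      exact absurd (Finset.mem_image_of_mem f (Finset.mem_univ i)) h
  rw [this]
  refine Finset.sum_nonneg fun t _ => ?_
  exact mul_star_self_nonneg _

theorem prod_pd {n : ℕ} {I : Type} (X : I → Type) (f : ∀ h : I, Fin n → X h) (S : Finset I)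
    (q : ℝ) (h0 : 0 ≤ q) (h1 : q ≤ 1) (c : Fin n → ℂ) :
    0 ≤ ∑ i, ∑ j, c i * (starRingEnd ℂ) (c j) *
      ∏ h ∈ S, (if f h i = f h j then (1 : ℂ) else (q : ℂ)) := by
  have key : ∀ i j, ∏ h ∈ S, (if f h i = f h j then (1 : ℂ) else (q : ℂ)) =
      ∑ T ∈ S.powerset, (((1 - q) ^ T.card * q ^ (S \ T).card : ℝ) : ℂ) *
        (if (fun h : T => f h i) = (fun h : T => f h j) then 1 else 0) := by
    intro i j
    have : ∀ h, (if f h i = f h j then (1 : ℂ) else (q : ℂ)) =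
        (1 - (q : ℂ)) * (if f h i = f h j then 1 else 0) + q := by
      intro h; split_ifs <;> simp
    simp_rw [this]
    rw [Finset.prod_add]
    refine Finset.sum_congr rfl fun T _ => ?_
    rw [Finset.prod_mul_distrib, Finset.prod_const, Finset.prod_const]
    have e : (∏ h ∈ T, (if f h i = f h j then (1 : ℂ) else 0)) =
        (if (fun h : T => f h i) = (fun h : T => f h j) then 1 else 0) := by
      rw [Finset.prod_ite_zero]
      simp [funext_iff]
    rw [e]
    push_cast
    ring
  simp_rw [key, Finset.mul_sum]
  have : ∑ i, ∑ j, ∑ T ∈ S.powerset, c i * (starRingEnd ℂ) (c j) *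
        ((((1 - q) ^ T.card * q ^ (S \ T).card : ℝ) : ℂ) *
        (if (fun h : T => f h i) = (fun h : T => f h j) then 1 else 0))
      = ∑ T ∈ S.powerset, (((1 - q) ^ T.card * q ^ (S \ T).card : ℝ) : ℂ) *
        ∑ i, ∑ j, c i * (starRingEnd ℂ) (c j) *
        (if (fun h : T => f h i) = (fun h : T => f h j) then 1 else 0) := by
    simp_rw [Finset.mul_sum]
    conv_rhs => rw [Finset.sum_comm]
    refine Finset.sum_congr rfl fun i _ => ?_
    conv_rhs => rw [Finset.sum_comm]
    refine Finset.sum_congr rfl fun j _ => ?_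
    refine Finset.sum_congr rfl fun T _ => ?_
    ring
  rw [this]
  refine Finset.sum_nonneg fun T _ => mul_nonneg ?_ ?_
  · rw [Complex.zero_le_real]
    have : 0 ≤ 1 - q := by linarith
    positivity
  · convert indicator_pd (fun i => (fun h : T => f h i)) c

end Helpers

section Statements

variable {V : Type} [Fintype V] (Γ : SimpleGraph V) (G : V → Type) [∀ v, Group (G v)]

theorem stmt19 (r : ℝ) (hr : 0 < r) :
    IsPosDefFn (fun g : GraphProduct Γ G =>
      (Real.exp (-(redLength Γ G g : ℝ) / r) : ℂ)) := by
  classical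
  intro n c x
  choose S hS hcard using fun i j => exists_sep Γ G (x i) (x j)
  have hq0 : 0 ≤ Real.exp (-1 / r) := (Real.exp_pos _).le
  have hq1 : Real.exp (-1 / r) ≤ 1 := by
    rw [Real.exp_le_one_iff]
    exact div_nonpos_of_nonpos_of_nonneg (by norm_num) hr.le
  let U : Finset (GpHyp Γ G) := Finset.univ.biUnion fun p : Fin n × Fin n => S p.1 p.2
  have := prod_pd (fun h : GpHyp Γ G => G h.1) (fun h i => hypF Γ G h (x i)) U
    (Real.exp (-1 / r)) hq0 hq1 c
  convert this using 7 with i _ j _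
  have e : U.filter (fun h => ¬ hypF Γ G h (x i) = hypF Γ G h (x j)) = S i j := by
    ext h
    rw [Finset.mem_filter, hS]
    refine ⟨fun h => h.2, fun hh => ⟨?_, hh⟩⟩
    exact Finset.mem_biUnion.2 ⟨(i, j), Finset.mem_univ _, (hS i j h).2 hh⟩
  rw [Finset.prod_ite, Finset.prod_const_one, one_mul, Finset.prod_const, e, hcard,
    ← Complex.ofReal_pow, ← Real.exp_nat_mul]
  dsimp only
  congr 2
  ring

end Statements
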